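/- arXiv:2502.10052 — 2 statements merged into one kernel-verified Lean document; each statement's English description precedes it below -/
import Mathlib

section
/- Let D = (V+r, E) be a rooted digraph and e = (u,v) an edge of D with u, v ∈ V. Then the following are equivalent: (1) u ∈ T_v (that is, e does not enter T_v); (2) for every w ∈ V, no w-tight set is entered by e; equivalently, λ_{D−e}(r,w) = λ_D(r,w) holds for every w ∈ V, where D−e is obtained from D by deleting the edge e. -/
/- Common setup: a rooted digraph `D = (V+r, E)` is modelled as a finite
vertex type `α` (whose elements are `V ∪ {r}`), a finite edge type `E`
(allowing parallel edges, i.e. a multigraph) and maps `tail head : E → α`.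
Subgraphs / edge subsets are sets `F : Set E`; the whole digraph `D`
corresponds to the edge set `Set.univ`.  "`v ∈ V`" is rendered as `v ≠ r`,
and a vertex subset `X ⊆ V` as `X : Set α` with `r ∉ X`. -/

/-- In-degree of the vertex `v` in the digraph with edge set `F`. -/
noncomputable def inDeg {α E : Type*} (head : E → α) (F : Set E) (v : α) : ℕ :=
  {e ∈ F | head e = v}.ncard

/-- `ϱ_F(X)`: the number of edges of `F` entering the vertex set `X`
(tail outside `X`, head in `X`). -/
noncomputable def rho {α E : Type*} (tail head : E → α) (F : Set E) (X : Set α) : ℕ :=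
  {e ∈ F | tail e ∉ X ∧ head e ∈ X}.ncard

/-- `p` is a directed path from `r` to `v` using edges of `F`:
a nonempty list of consecutive edges, starting at `r`, ending at `v`, and
visiting pairwise distinct vertices. -/
def IsRVPath {α E : Type*} (tail head : E → α) (F : Set E) (r v : α) (p : List E) : Prop :=
  (∀ e ∈ p, e ∈ F) ∧
  List.Chain' (fun e f => head e = tail f) p ∧
  (p.map tail).Nodup ∧ (∀ e ∈ p, tail e ≠ v) ∧
  (∃ e, p.head? = some e ∧ tail e = r) ∧
  (∃ e, p.getLast? = some e ∧ head e = v)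

/-- There exist `n` pairwise edge-disjoint directed paths from `r` to `v`
in the edge set `F`. -/
def HasEDPaths {α E : Type*} (tail head : E → α) (F : Set E) (r v : α) (n : ℕ) : Prop :=
  ∃ P : Fin n → List E, (∀ i, IsRVPath tail head F r v (P i)) ∧
    ∀ i j, i ≠ j → ∀ e, e ∈ P i → e ∉ P j

/-- `λ_F(r,v)`: the local edge-connectivity from `r` to `v`, i.e. the maximum
number of pairwise edge-disjoint directed paths from `r` to `v` in `F`. -/
noncomputable def lam {α E : Type*} (tail head : E → α) (F : Set E) (r v : α) : ℕ :=
  sSup {n | HasEDPaths tail head F r v n}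

/-- `X` is a `v`-tight vertex set in the digraph with edge set `F` and root `r`:
`X ⊆ V` (i.e. `r ∉ X`), `v ∈ X` and `ϱ_F(X) = λ_F(r,v)`. -/
def Tight {α E : Type*} (tail head : E → α) (F : Set E) (r v : α) (X : Set α) : Prop :=
  v ∈ X ∧ r ∉ X ∧ rho tail head F X = lam tail head F r v

/-- The digraph with edge set `F` is a flame with root `r`:
`λ_F(r,v) = ϱ_F(v)` for every `v ∈ V`. -/
def IsFlame {α E : Type*} (tail head : E → α) (F : Set E) (r : α) : Prop :=
  ∀ v, v ≠ r → lam tail head F r v = inDeg head F v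

/-- `F` is a maximal flame within the ambient edge set `A`:
`λ_A(r,v) = λ_F(r,v) = ϱ_F(v)` for every `v ∈ V`. -/
def IsMaxFlameIn {α E : Type*} (tail head : E → α) (A : Set E) (r : α) (F : Set E) : Prop :=
  F ⊆ A ∧ ∀ v, v ≠ r →
    lam tail head A r v = lam tail head F r v ∧
    lam tail head F r v = inDeg head F v

/-- A closed directed walk in `F` with pairwise distinct edges.  (If every
vertex is entered by at most one edge of `F`, the existence of such a walk is
equivalent to the existence of an undirected cycle in `F`.) -/
def IsDicycle {α E : Type*} (tail head : E → α) (F : Set E) (p : List E) : Prop :=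
  p.Nodup ∧ (∀ e ∈ p, e ∈ F) ∧
  List.Chain' (fun e f => head e = tail f) p ∧
  (∃ e f, p.head? = some e ∧ p.getLast? = some f ∧ head f = tail e)

/-- `B` is a branching: every vertex is entered by at most one edge of `B` and,
disregarding edge directions, `B` contains no cycle (under the in-degree
condition this is equivalent to containing no directed cycle). -/
def IsBranching {α E : Type*} (tail head : E → α) (B : Set E) : Prop :=
  (∀ v, inDeg head B v ≤ 1) ∧ ∀ p : List E, ¬ IsDicycle tail head B p

/-- The head-set of an edge set `B`: the vertices entered by an edge of `B`. -/
def headSet {α E : Type*} (head : E → α) (B : Set E) : Set α := {v | ∃ e ∈ B, head e = v}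

/-- Independence in the gammoid `G_D(v)` (with `D` the whole digraph, edge set
`Set.univ`): `X ⊆ in_D(v)` is independent if there are `|X|` pairwise
edge-disjoint directed paths from `r` to `v` in `D` whose set of last edges is
exactly `X`. -/
def GammoidIndep {α E : Type*} (tail head : E → α) (r v : α) (X : Set E) : Prop :=
  ∃ P : Fin X.ncard → List E,
    (∀ i, IsRVPath tail head Set.univ r v (P i)) ∧
    (∀ i j, i ≠ j → ∀ e, e ∈ P i → e ∉ P j) ∧
    (∀ e, e ∈ X ↔ ∃ i, (P i).getLast? = some e)

section RootedCuts

variable {α E : Type*} {tail head : E → α} {r w : α}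

lemma rho_mono [Finite E] {F G : Set E} (h : F ⊆ G) (X : Set α) :
    rho tail head F X ≤ rho tail head G X :=
  Set.ncard_le_ncard (fun _ hx => ⟨h hx.1, hx.2⟩)

lemma rho_union_add_rho_inter_le [Finite E] (F : Set E) (X Y : Set α) :
    rho tail head F (X ∩ Y) + rho tail head F (X ∪ Y) ≤
      rho tail head F X + rho tail head F Y := by
  unfold rho
  rw [← Set.ncard_union_add_ncard_inter {e ∈ F | tail e ∉ X ∩ Y ∧ head e ∈ X ∩ Y},
    ← Set.ncard_union_add_ncard_inter {e ∈ F | tail e ∉ X ∧ head e ∈ X}]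
  refine add_le_add (Set.ncard_le_ncard fun x => ?_) (Set.ncard_le_ncard fun x => ?_) <;>
    simp only [Set.mem_union, Set.mem_inter_iff, Set.mem_ofPred_eq] <;> tauto

lemma rho_diff_singleton_of_enters [Finite E] {F : Set E} {X : Set α} {f : E} (hf : f ∈ F)
    (hX : tail f ∉ X ∧ head f ∈ X) :
    rho tail head (F \ {f}) X + 1 = rho tail head F X := by
  unfold rho
  rw [← Set.ncard_sdiff_singleton_add_one (s := {e ∈ F | tail e ∉ X ∧ head e ∈ X}) ⟨hf, hX⟩]
  congr 2
  ext x
  simp only [Set.mem_sdiff, Set.mem_ofPred_eq, Set.mem_singleton_iff]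
  tauto

lemma rho_diff_singleton_of_not_enters {F : Set E} {X : Set α} {f : E}
    (hX : ¬(tail f ∉ X ∧ head f ∈ X)) :
    rho tail head (F \ {f}) X = rho tail head F X := by
  unfold rho
  congr 1
  ext x
  simp only [Set.mem_sdiff, Set.mem_ofPred_eq, Set.mem_singleton_iff]
  constructor
  · tauto
  · rintro ⟨h1, h2⟩
    exact ⟨⟨h1, fun h => hX (h ▸ h2)⟩, h2⟩

lemma rho_le_rho_diff_singleton_add_one [Finite E] (F : Set E) (X : Set α) (f : E) :
    rho tail head F X ≤ rho tail head (F \ {f}) X + 1 := by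
  by_cases hf : f ∈ F
  · by_cases hX : tail f ∉ X ∧ head f ∈ X
    · exact (rho_diff_singleton_of_enters hf hX).ge
    · exact (rho_diff_singleton_of_not_enters hX).ge.trans (Nat.le_succ _)
  · rw [Set.sdiff_singleton_eq_self hf]
    exact Nat.le_succ _

lemma IsRVPath.mono {F G : Set E} {p : List E} (hp : IsRVPath tail head F r w p)
    (h : F ⊆ G) : IsRVPath tail head G r w p :=
  ⟨fun e he => h (hp.1 e he), hp.2⟩

lemma HasEDPaths.mono {F G : Set E} {n : ℕ} (hF : HasEDPaths tail head F r w n)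
    (h : F ⊆ G) : HasEDPaths tail head G r w n :=
  hF.imp fun _ hP => ⟨fun i => (hP.1 i).mono h, hP.2⟩

lemma exists_mem_enters_of_chain {X : Set α} (hw : w ∈ X) :
    ∀ (p : List E) (r : α), r ∉ X → List.IsChain (fun e f => head e = tail f) p →
      (∃ e, p.head? = some e ∧ tail e = r) → (∃ e, p.getLast? = some e ∧ head e = w) →
      ∃ e ∈ p, tail e ∉ X ∧ head e ∈ X := by
  intro p
  induction p with
  | nil => simp
  | cons a l ih =>
    intro r hr hc h1 h2
    simp only [List.head?_cons, Option.some.injEq, exists_eq_left'] at h1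
    by_cases ha : head a ∈ X
    · exact ⟨a, by simp, h1 ▸ hr, ha⟩
    · cases l with
      | nil =>
        simp only [List.getLast?_singleton, Option.some.injEq, exists_eq_left'] at h2
        exact absurd (h2 ▸ hw) ha
      | cons b l =>
        rw [List.isChain_cons_cons] at hc
        obtain ⟨e, he, h⟩ := ih (head a) ha hc.2 ⟨b, rfl, hc.1.symm⟩
          (by simpa [List.getLast?_cons_cons] using h2)
        exact ⟨e, List.mem_cons_of_mem _ he, h⟩

lemma HasEDPaths.le_rho [Finite E] {F : Set E} {n : ℕ} (h : HasEDPaths tail head F r w n)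
    {X : Set α} (hw : w ∈ X) (hr : r ∉ X) : n ≤ rho tail head F X := by
  obtain ⟨P, hP, hd⟩ := h
  choose g hg hX using fun i =>
    exists_mem_enters_of_chain hw (P i) r hr (hP i).2.1 (hP i).2.2.2.2.1 (hP i).2.2.2.2.2
  have hinj : Function.Injective g := fun i j hij => by
    by_contra hne
    exact hd i j hne (g i) (hg i) (hij ▸ hg j)
  have hcard : (Set.range g).ncard = n := by
    rw [← Set.image_univ, Set.ncard_image_of_injective _ hinj, Set.ncard_univ, Nat.card_fin]
  rw [← hcard]
  refine Set.ncard_le_ncard ?_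
  rintro _ ⟨i, rfl⟩
  exact ⟨(hP i).1 _ (hg i), hX i⟩

lemma bddAbove_hasEDPaths [Finite E] (F : Set E) (hw : w ≠ r) :
    BddAbove {n | HasEDPaths tail head F r w n} :=
  ⟨rho tail head F {w}, fun _ hn => HasEDPaths.le_rho hn rfl (by simpa using hw.symm)⟩

lemma hasEDPaths_zero (F : Set E) : HasEDPaths tail head F r w 0 :=
  ⟨fun i => i.elim0, fun i => i.elim0, fun i => i.elim0⟩

lemma hasEDPaths_lam [Finite E] (F : Set E) (hw : w ≠ r) :
    HasEDPaths tail head F r w (lam tail head F r w) :=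
  Nat.sSup_mem ⟨0, hasEDPaths_zero F⟩ (bddAbove_hasEDPaths F hw)

lemma HasEDPaths.le_lam [Finite E] {F : Set E} {n : ℕ} (h : HasEDPaths tail head F r w n)
    (hw : w ≠ r) : n ≤ lam tail head F r w :=
  le_csSup (bddAbove_hasEDPaths F hw) h

lemma lam_le_rho [Finite E] (F : Set E) {X : Set α} (hw : w ∈ X) (hr : r ∉ X) :
    lam tail head F r w ≤ rho tail head F X :=
  (hasEDPaths_lam F (fun h : w = r => hr (h ▸ hw))).le_rho hw hr

lemma lam_mono [Finite E] {F G : Set E} (h : F ⊆ G) (hw : w ≠ r) :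
    lam tail head F r w ≤ lam tail head G r w :=
  ((hasEDPaths_lam F hw).mono h).le_lam hw

/-- A path can be extended backwards by an edge, up to discarding a closed part. -/
lemma IsRVPath.exists_path_cons {F : Set E} {f : E} {p : List E} (hf : f ∈ F)
    (hfw : tail f ≠ w) (hp : IsRVPath tail head F (head f) w p) :
    ∃ q, IsRVPath tail head F (tail f) w q ∧ q ⊆ f :: p := by
  obtain ⟨h1, h2, h3, h4, h5, h6⟩ := hp
  by_cases hx : tail f ∈ p.map tail
  · obtain ⟨g, hg, hgf⟩ := List.mem_map.1 hx
    obtain ⟨l₁, l₂, rfl⟩ := List.append_of_mem hg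
    refine ⟨g :: l₂, ⟨fun e he => h1 e (by simp_all), (List.isChain_append.1 h2).2.1, ?_,
      fun e he => h4 e (by simp_all), ⟨g, rfl, hgf⟩, ?_⟩, ?_⟩
    · rw [List.map_append] at h3
      exact h3.of_append_right
    · rwa [List.getLast?_append_of_ne_nil _ (List.cons_ne_nil _ _)] at h6
    · exact fun e he => List.mem_cons_of_mem _ (List.mem_append_right _ he)
  · refine ⟨f :: p, ⟨?_, ?_, ?_, ?_, ⟨f, rfl, rfl⟩, ?_⟩, List.Subset.refl _⟩
    · simpa [hf] using h1
    · refine List.isChain_cons.2 ⟨fun y hy => ?_, h2⟩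
      obtain ⟨e, he, het⟩ := h5
      rw [he, Option.mem_some_iff] at hy
      rw [← hy, het]
    · rw [List.map_cons]
      exact List.nodup_cons.2 ⟨hx, h3⟩
    · simpa [hfw] using h4
    · obtain ⟨e, he, hew⟩ := h6
      exact ⟨e, by simp [List.getLast?_cons, he], hew⟩

/-- If deleting the edge `f = (x, y)` leaves every cut with at least `m` edges, and either
`y = w` or there is a path from `y` to `w` whose deletion preserves this, then the same
holds for `x`. -/
lemma exists_path_preserving_cuts_cons [Finite E] {G : Set E} {m : ℕ} {f : E} (hf : f ∈ G)
    (hfw : tail f ≠ w)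
    (hcut : ∀ X : Set α, w ∈ X → r ∉ X → m ≤ rho tail head (G \ {f}) X)
    (hpath : head f ≠ w → ∃ p, IsRVPath tail head (G \ {f}) (head f) w p ∧
      ∀ X : Set α, w ∈ X → r ∉ X → m ≤ rho tail head ((G \ {f}) \ {e | e ∈ p}) X) :
    ∃ p, IsRVPath tail head G (tail f) w p ∧
      ∀ X : Set α, w ∈ X → r ∉ X → m ≤ rho tail head (G \ {e | e ∈ p}) X := by
  by_cases hy : head f = w
  · refine ⟨[f], ⟨by simpa using hf, List.isChain_singleton f, by simp, by simpa using hfw, by simp,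
      by simpa using hy⟩, fun X hX hr => ?_⟩
    have h : {e | e ∈ [f]} = {f} := by ext; simp
    rw [h]
    exact hcut X hX hr
  · obtain ⟨p, hp, hpc⟩ := hpath hy
    obtain ⟨q, hq, hqp⟩ := (hp.mono Set.sdiff_subset).exists_path_cons hf hfw
    refine ⟨q, hq, fun X hX hr => (hpc X hX hr).trans (rho_mono ?_ X)⟩
    rintro a ⟨⟨haG, haf⟩, hap⟩
    refine ⟨haG, fun haq => ?_⟩
    rcases List.mem_cons.1 (hqp haq) with h | h
    · exact haf h
    · exact hap h

lemma exists_path_preserving_cuts_of_critical [Finite α] [Finite E] {m : ℕ} :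
    ∀ (G : Set E) (x : α) (M : Set α), x ≠ w →
      (∀ X : Set α, w ∈ X → r ∉ X → m ≤ rho tail head G X) →
      (∀ X : Set α, w ∈ X → r ∉ X → x ∉ X → m + 1 ≤ rho tail head G X) →
      w ∈ M → x ∈ M → r ∉ M → rho tail head G M = m →
      ∃ p, IsRVPath tail head G x w p ∧
        ∀ X : Set α, w ∈ X → r ∉ X → m ≤ rho tail head (G \ {e | e ∈ p}) X := by
  intro G
  induction hn : G.ncard using Nat.strong_induction_on generalizing G with
  | _ n ih =>
  subst hn
  intro x M₀ hxw hcut hcut' hwM₀ hxM₀ hrM₀ hM₀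
  obtain ⟨M, ⟨hwM, hxM, hrM, hM⟩, hmin⟩ :=
    (Set.toFinite {X : Set α | w ∈ X ∧ x ∈ X ∧ r ∉ X ∧ rho tail head G X = m}).exists_minimal
      ⟨M₀, hwM₀, hxM₀, hrM₀, hM₀⟩
  have hle : ∀ X : Set α, w ∈ X → x ∈ X → r ∉ X → rho tail head G X = m → M ⊆ X := by
    intro X hwX hxX hrX hX
    have hsub := rho_union_add_rho_inter_le (tail := tail) (head := head) G X M
    have h₁ := hcut (X ∩ M) ⟨hwX, hwM⟩ (fun h => hrX h.1)
    have h₂ := hcut (X ∪ M) (Or.inl hwX) (fun h => h.elim hrX hrM)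
    have hXM : rho tail head G (X ∩ M) = m := by omega
    exact (hmin (y := X ∩ M) ⟨⟨hwX, hwM⟩, ⟨hxX, hxM⟩, fun h => hrX h.1, hXM⟩
      Set.inter_subset_right).trans Set.inter_subset_left
  obtain ⟨f, ⟨hfG, hft, hfh⟩, hfM⟩ : ∃ f ∈ {e ∈ G | tail e ∉ M \ {x} ∧ head e ∈ M \ {x}},
      f ∉ {e ∈ G | tail e ∉ M ∧ head e ∈ M} := by
    by_contra! hcon
    have h₁ := Set.ncard_le_ncard hcon
    have h₂ := hcut' (M \ {x}) ⟨hwM, hxw.symm⟩ (fun h => hrM h.1) (fun h => h.2 rfl)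
    unfold rho at h₂ hM
    omega
  have htM : tail f ∈ M := by
    by_contra h
    exact hfM ⟨hfG, h, hfh.1⟩
  obtain rfl : tail f = x := by
    by_contra h
    exact hft ⟨htM, h⟩
  have hcutf : ∀ X : Set α, w ∈ X → r ∉ X → m ≤ rho tail head (G \ {f}) X := by
    intro X hwX hrX
    by_cases ht : tail f ∈ X
    · rw [rho_diff_singleton_of_not_enters (by tauto)]
      exact hcut X hwX hrX
    · have h₁ := hcut' X hwX hrX ht
      have h₂ := rho_le_rho_diff_singleton_add_one (tail := tail) (head := head) G X f
      omega
  refine exists_path_preserving_cuts_cons hfG hxw hcutf fun hyw => ?_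
  refine ih _ (Set.ncard_sdiff_singleton_lt_of_mem hfG) (G \ {f}) rfl (head f) M hyw hcutf ?_
    hwM hfh.1 hrM ?_
  · intro X hwX hrX hyX
    rw [rho_diff_singleton_of_not_enters (by tauto)]
    by_cases ht : tail f ∈ X
    · refine lt_of_le_of_ne (hcut X hwX hrX) fun h => hyX (hle X hwX ht hrX h.symm hfh.1)
    · exact hcut' X hwX hrX ht
  · rw [rho_diff_singleton_of_not_enters (by tauto), hM]

lemma exists_path_preserving_cuts [Finite α] [Finite E] {m : ℕ} (hw : w ≠ r) (F : Set E)
    (hF : ∀ X : Set α, w ∈ X → r ∉ X → m + 1 ≤ rho tail head F X) :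
    ∃ p, IsRVPath tail head F r w p ∧
      ∀ X : Set α, w ∈ X → r ∉ X → m ≤ rho tail head (F \ {e | e ∈ p}) X := by
  obtain ⟨G, hGF, hG⟩ := (Set.toFinite {G : Set E | ∀ X : Set α, w ∈ X → r ∉ X →
    m + 1 ≤ rho tail head G X}).exists_le_minimal hF
  have hcut := hG.1
  obtain ⟨f, hfG, hft, -⟩ : {e ∈ G | tail e ∉ ({r}ᶜ : Set α) ∧ head e ∈ ({r}ᶜ : Set α)}.Nonempty :=
    Set.nonempty_of_ncard_ne_zero (by
      have := hcut {r}ᶜ hw (by simp)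
      unfold rho at this
      omega)
  simp only [Set.mem_compl_iff, Set.mem_singleton_iff, not_not] at hft
  obtain ⟨N, hwN, hrN, hN⟩ : ∃ N : Set α, w ∈ N ∧ r ∉ N ∧ rho tail head (G \ {f}) N ≤ m := by
    by_contra! hcon
    exact (hG.2 (y := G \ {f}) hcon Set.sdiff_subset hfG).2 rfl
  have hNG := hcut N hwN hrN
  have hfN : tail f ∉ N ∧ head f ∈ N := by
    by_contra h
    rw [rho_diff_singleton_of_not_enters h] at hN
    omega
  have hNf := rho_diff_singleton_of_enters hfG hfN
  have hcutf : ∀ X : Set α, w ∈ X → r ∉ X → m ≤ rho tail head (G \ {f}) X := by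
    intro X hwX hrX
    have h₁ := hcut X hwX hrX
    have h₂ := rho_le_rho_diff_singleton_add_one (tail := tail) (head := head) G X f
    omega
  obtain ⟨p, hp, hpc⟩ := exists_path_preserving_cuts_cons hfG (hft ▸ hw.symm) hcutf fun hyw =>
    exists_path_preserving_cuts_of_critical (G \ {f}) (head f) N hyw hcutf
      (fun X hwX hrX hyX => by
        rw [rho_diff_singleton_of_not_enters (by tauto)]
        exact hcut X hwX hrX)
      hwN hfN.2 hrN (by omega)
  rw [hft] at hp
  exact ⟨p, hp.mono hGF, fun X hwX hrX =>
    (hpc X hwX hrX).trans (rho_mono (Set.sdiff_subset_sdiff_left hGF) X)⟩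

/-- Menger's theorem: if every cut separating `w` from `r` has at least `k` edges, then there
are `k` edge-disjoint paths from `r` to `w`. -/
theorem hasEDPaths_of_forall_le_rho [Finite α] [Finite E] (hw : w ≠ r) (k : ℕ) (F : Set E)
    (hF : ∀ X : Set α, w ∈ X → r ∉ X → k ≤ rho tail head F X) :
    HasEDPaths tail head F r w k := by
  induction k generalizing F with
  | zero => exact hasEDPaths_zero F
  | succ k ih =>
    obtain ⟨p, hp, hpc⟩ := exists_path_preserving_cuts hw F hF
    obtain ⟨P, hP, hd⟩ := ih _ hpc
    refine ⟨Fin.cons p P, fun i => ?_, fun i j => ?_⟩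
    · refine Fin.cases hp (fun i => ?_) i
      exact (hP i).mono Set.sdiff_subset
    · refine Fin.cases ?_ (fun i => ?_) i <;> refine Fin.cases ?_ (fun j => ?_) j
      · simp
      · exact fun _ e he he' => ((hP j).1 e he').2 he
      · exact fun _ e he he' => ((hP i).1 e he).2 he'
      · exact fun hij => hd i j fun h => hij (by rw [h])

lemma exists_rho_eq_lam [Finite α] [Finite E] (F : Set E) (hw : w ≠ r) :
    ∃ X : Set α, w ∈ X ∧ r ∉ X ∧ rho tail head F X = lam tail head F r w := by
  by_contra! hcon
  have h := hasEDPaths_of_forall_le_rho hw (lam tail head F r w + 1) F fun X hwX hrX =>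
    lt_of_le_of_ne (lam_le_rho F hwX hrX) (hcon X hwX hrX).symm
  exact absurd (h.le_lam hw) (by omega)

/-- Deleting an edge `e` preserves the local edge-connectivity to `w` exactly when `e` enters no
`w`-tight set. -/
lemma lam_diff_singleton_eq_iff [Finite α] [Finite E] (e : E) (hw : w ≠ r) :
    lam tail head (Set.univ \ {e}) r w = lam tail head Set.univ r w ↔
      ∀ X : Set α, Tight tail head Set.univ r w X → ¬(tail e ∉ X ∧ head e ∈ X) := by
  constructor
  · rintro h X ⟨hwX, hrX, hX⟩ he
    have h₁ := rho_diff_singleton_of_enters (Set.mem_univ e) he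
    have h₂ := lam_le_rho (tail := tail) (head := head) (Set.univ \ {e}) hwX hrX
    omega
  · intro h
    refine (lam_mono Set.sdiff_subset hw).antisymm ?_
    obtain ⟨X, hwX, hrX, hX⟩ :=
      exists_rho_eq_lam (tail := tail) (head := head) (Set.univ \ {e}) hw
    have h₁ := lam_le_rho (tail := tail) (head := head) Set.univ hwX hrX
    by_contra! hlt
    have h₂ := rho_le_rho_diff_singleton_add_one (tail := tail) (head := head) Set.univ X e
    have h₃ := h X ⟨hwX, hrX, by omega⟩
    rw [rho_diff_singleton_of_not_enters h₃] at hX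
    omega

lemma Tight.inter [Finite E] {F : Set E} {v : α} {T X : Set α} (hT : Tight tail head F r v T)
    (hX : Tight tail head F r w X) (hv : v ∈ X) : Tight tail head F r v (T ∩ X) := by
  obtain ⟨hvT, hrT, hT⟩ := hT
  obtain ⟨hwX, hrX, hX⟩ := hX
  have hsub := rho_union_add_rho_inter_le (tail := tail) (head := head) F T X
  have hrI : r ∉ T ∩ X := fun h => hrT h.1
  have h₁ := lam_le_rho (tail := tail) (head := head) F (show v ∈ T ∩ X from ⟨hvT, hv⟩) hrI
  have h₂ := lam_le_rho (tail := tail) (head := head) F (show w ∈ T ∪ X from Or.inr hwX)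
    (fun h => h.elim hrT hrX)
  exact ⟨⟨hvT, hv⟩, hrI, by omega⟩

end RootedCuts

/-- for an edge `e = (u,v)` with `u, v ∈ V` the following are
equivalent: (1) `u ∈ T_v`, the smallest `v`-tight set (i.e. `e` does not enter
`T_v`); (2) no `w`-tight set is entered by `e` for any `w ∈ V`; equivalently,
`λ_{D−e}(r,w) = λ_D(r,w)` for every `w ∈ V`. -/
theorem tail_mem_smallest_tight_iff
    {α E : Type*} [Fintype α] [Fintype E]
    (tail head : E → α) (r : α) (e : E)
    (hu : tail e ≠ r) (hv : head e ≠ r)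
    (T : Set α)
    (hT : Tight tail head Set.univ r (head e) T ∧
      ∀ X : Set α, Tight tail head Set.univ r (head e) X → T ⊆ X) :
    (tail e ∈ T ↔
      ∀ w, w ≠ r → ∀ X : Set α, Tight tail head Set.univ r w X →
        ¬(tail e ∉ X ∧ head e ∈ X)) ∧
    (tail e ∈ T ↔
      ∀ w, w ≠ r → lam tail head (Set.univ \ {e}) r w = lam tail head Set.univ r w) := by
  have key : tail e ∈ T ↔ ∀ w, w ≠ r → ∀ X : Set α, Tight tail head Set.univ r w X →
      ¬(tail e ∉ X ∧ head e ∈ X) := by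
    constructor
    · rintro ht w - X hX ⟨htX, hhX⟩
      exact htX (hT.2 _ (hT.1.inter hX hhX) ht).2
    · intro h
      by_contra ht
      exact h _ hv T hT.1 ⟨ht, hT.1.1⟩
  exact ⟨key, key.trans (forall₂_congr fun w hw => (lam_diff_singleton_eq_iff e hw).symm)⟩
end

section
/- Let D = (V+r, E) be a rooted digraph and v ∈ V. Define a set X ⊆ in_D(v) to be independent if there exist |X| pairwise edge-disjoint directed paths from r to v in D whose set of last edges is exactly X. Then this family of independent sets forms a matroid G_D(v) on the ground set in_D(v): the empty set is independent, subsets of independent sets are independent, and for independent X, Y with |X| < |Y| there exists e ∈ Y \ X such that X + e is independent. -/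
open Classical in
/-- In-degree minus out-degree of `w` with respect to the edge set `F`. -/
noncomputable def excess {α E : Type*} (tail head : E → α) (F : Finset E) (w : α) : ℤ :=
  ∑ e ∈ F, ((if head e = w then 1 else 0) - (if tail e = w then 1 else 0))

/-- `F` is the edge set of an integral `r`-`v` flow (with unit capacities) that does not use
edges leaving `v` and whose set of edges entering `v` is `X`. -/
structure IsFlow {α E : Type*} (tail head : E → α) (r v : α) (F X : Finset E) : Prop where
  tail_ne : ∀ e ∈ F, tail e ≠ v
  mem_iff : ∀ e, e ∈ X ↔ e ∈ F ∧ head e = v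
  excess_root : r ≠ v → excess tail head F r = -(X.card : ℤ)
  excess_eq_zero : ∀ w, w ≠ v → w ≠ r → excess tail head F w = 0

/-- A path from each member of `X` back to `r`, all paths being pairwise edge-disjoint, inside `F`. -/
def IsLinking {α E : Type*} (tail head : E → α) (r v : α) (F X : Set E) (P : E → List E) : Prop :=
  (∀ e ∈ X, IsRVPath tail head F r v (P e) ∧ (P e).getLast? = some e) ∧
    ∀ e ∈ X, ∀ f ∈ X, e ≠ f → ∀ g, g ∈ P e → g ∉ P f

/-- `IsTrail tail head r p u`: the reverse of the list `p` is a directed path from `r` to `u`. -/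
inductive IsTrail {α E : Type*} (tail head : E → α) (r : α) : List E → α → Prop
  | nil : IsTrail tail head r [] r
  | cons (e : E) (p : List E) : IsTrail tail head r p (tail e) → head e ∉ (e :: p).map tail →
      IsTrail tail head r (e :: p) (head e)

section Linkings

variable {α E : Type*} {tail head : E → α} {r v : α}

lemma gammoidIndep_iff_exists_isLinking [Finite E] {X : Set E} :
    GammoidIndep tail head r v X ↔ ∃ P, IsLinking tail head r v Set.univ X P := by
  classical
  constructor
  · rintro ⟨P, hP, hd, hX⟩
    have hex : ∀ e ∈ X, ∃ Q, Q.getLast? = some e ∧ ∃ i, P i = Q := fun e he =>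
      let ⟨i, hi⟩ := (hX e).1 he
      ⟨P i, hi, i, rfl⟩
    choose! Q hQ hPQ using hex
    refine ⟨Q, fun e he => ⟨?_, hQ e he⟩, fun e he f hf hef => ?_⟩
    · obtain ⟨i, hi⟩ := hPQ e he
      exact hi ▸ hP i
    · obtain ⟨i, hi⟩ := hPQ e he
      obtain ⟨j, hj⟩ := hPQ f hf
      rw [← hi, ← hj]
      refine hd i j ?_
      rintro rfl
      have h := hQ e he
      rw [← hi, hj, hQ f hf] at h
      exact hef (Option.some.inj h).symm
  · rintro ⟨P, hP, hd⟩
    have σ : Fin X.ncard ≃ X := (Finite.equivFinOfCardEq (Nat.card_coe_set_eq X)).symm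
    refine ⟨fun i => P (σ i), fun i => (hP _ (σ i).2).1, fun i j hij => ?_, fun e => ⟨?_, ?_⟩⟩
    · exact hd _ (σ i).2 _ (σ j).2 fun h => hij (σ.injective (Subtype.ext h))
    · intro he
      exact ⟨σ.symm ⟨e, he⟩, by simpa using (hP e he).2⟩
    · rintro ⟨i, hi⟩
      have := (hP _ (σ i).2).2
      rw [hi] at this
      rw [Option.some.inj this]
      exact (σ i).2

lemma IsLinking.mono {F X Y : Set E} {P : E → List E} (h : IsLinking tail head r v F X P)
    (hYX : Y ⊆ X) : IsLinking tail head r v F Y P :=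
  ⟨fun e he => h.1 e (hYX he), fun e he f hf => h.2 e (hYX he) f (hYX hf)⟩

lemma getLast?_eq_of_head_eq {p : List E} (hc : p.IsChain (fun e f => head e = tail f))
    (ht : ∀ e ∈ p, tail e ≠ v) {f : E} (hf : f ∈ p) (hv : head f = v) : p.getLast? = some f := by
  induction p with
  | nil => simp at hf
  | cons a p ih =>
    cases p with
    | nil => simp_all
    | cons b p =>
      rw [List.isChain_cons_cons] at hc
      have hfa : f ≠ a := by
        rintro rfl
        exact ht b (by simp) (hc.1.symm.trans hv)
      rw [List.getLast?_cons_cons]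
      exact ih hc.2 (fun e he => ht e (by simp [he])) (by simpa [hfa] using hf)

lemma excess_toFinset_of_chain [DecidableEq α] [DecidableEq E] {p : List E} (hn : p.Nodup)
    (hc : p.IsChain (fun e f => head e = tail f)) {a b : α}
    (ha : ∃ e, p.head? = some e ∧ tail e = a) (hb : ∃ e, p.getLast? = some e ∧ head e = b) (w : α) :
    excess tail head p.toFinset w = (if b = w then 1 else 0) - (if a = w then 1 else 0) := by
  induction p generalizing a with
  | nil => simp at ha
  | cons e p ih =>
    have he : tail e = a := by simpa using ha
    rw [List.nodup_cons] at hn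
    have hs : excess tail head (e :: p).toFinset w =
        (if head e = w then 1 else 0) - (if tail e = w then 1 else 0)
          + excess tail head p.toFinset w := by
      rw [List.toFinset_cons, excess, Finset.sum_insert (by simpa using hn.1), excess]
      congr!
    cases p with
    | nil =>
      have hb' : head e = b := by simpa using hb
      rw [hs, he, hb']
      simp [excess]
    | cons f p =>
      rw [List.isChain_cons_cons] at hc
      rw [hs, ih hn.2 hc.2 ⟨f, rfl, rfl⟩ (by simpa using hb), hc.1, he]
      ring

lemma IsRVPath.nodup {F : Set E} {p : List E} (h : IsRVPath tail head F r v p) : p.Nodup :=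
  h.2.2.1.of_map

lemma IsRVPath.excess_toFinset [DecidableEq α] [DecidableEq E] {F : Set E} {p : List E}
    (h : IsRVPath tail head F r v p) (w : α) :
    excess tail head p.toFinset w = (if v = w then 1 else 0) - (if r = w then 1 else 0) :=
  excess_toFinset_of_chain h.nodup h.2.1 h.2.2.2.2.1 h.2.2.2.2.2 w

lemma excess_insert [DecidableEq α] [DecidableEq E] {F : Finset E} {e : E} (he : e ∉ F) (w : α) :
    excess tail head (insert e F) w =
      excess tail head F w + ((if head e = w then 1 else 0) - (if tail e = w then 1 else 0)) := by
  rw [excess, Finset.sum_insert he, excess, add_comm]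
  congr!

lemma excess_erase [DecidableEq α] [DecidableEq E] {F : Finset E} {e : E} (he : e ∈ F) (w : α) :
    excess tail head (F.erase e) w =
      excess tail head F w - ((if head e = w then 1 else 0) - (if tail e = w then 1 else 0)) := by
  have := excess_insert (tail := tail) (head := head) (Finset.notMem_erase e F) w
  rw [Finset.insert_erase he] at this
  lia

lemma excess_sdiff [DecidableEq E] {F G : Finset E} (h : G ⊆ F) (w : α) :
    excess tail head (F \ G) w = excess tail head F w - excess tail head G w := by
  rw [excess, excess, excess, eq_sub_iff_add_eq, Finset.sum_sdiff h]

lemma exists_flow_of_isLinking [DecidableEq E] {X : Finset E} {P : E → List E}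
    (h : IsLinking tail head r v Set.univ X P) : ∃ F, IsFlow tail head r v F X := by
  classical
  have hex : ∀ w, excess tail head (X.biUnion fun e => (P e).toFinset) w =
      X.card * ((if v = w then 1 else 0) - (if r = w then 1 else 0)) := by
    intro w
    rw [excess, Finset.sum_biUnion, ← nsmul_eq_mul, ← Finset.sum_const]
    · exact Finset.sum_congr rfl fun e he => (h.1 e he).1.excess_toFinset w
    · intro e he f hf hef
      rw [Function.onFun, Finset.disjoint_left]
      simpa using h.2 e he f hf hef
  refine ⟨X.biUnion fun e => (P e).toFinset, ?_, ?_, ?_, ?_⟩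
  · intro f hf
    simp only [Finset.mem_biUnion, List.mem_toFinset] at hf
    obtain ⟨e, he, hf⟩ := hf
    exact (h.1 e he).1.2.2.2.1 f hf
  · intro f
    simp only [Finset.mem_biUnion, List.mem_toFinset]
    constructor
    · intro hf
      obtain ⟨hp, hl⟩ := h.1 f hf
      obtain ⟨g, hg, hgv⟩ := hp.2.2.2.2.2
      rw [hl] at hg
      cases hg
      exact ⟨⟨f, hf, List.mem_of_getLast? hl⟩, hgv⟩
    · rintro ⟨⟨e, he, hf⟩, hv⟩
      obtain ⟨hp, hl⟩ := h.1 e he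
      rw [getLast?_eq_of_head_eq hp.2.1 hp.2.2.2.1 hf hv] at hl
      cases hl
      exact he
  · intro hrv
    rw [hex, if_neg hrv.symm, if_pos rfl]
    ring
  · intro w hwv hwr
    rw [hex, if_neg hwv.symm, if_neg hwr.symm]
    ring

lemma IsTrail.exists_subset_of_mem {p : List E} {u z : α} (h : IsTrail tail head r p u)
    (hz : z ∈ p.map tail) : ∃ q, q ⊆ p ∧ IsTrail tail head r q z := by
  induction h with
  | nil => simp at hz
  | cons e p hp _ ih =>
    rw [List.map_cons, List.mem_cons] at hz
    rcases hz with rfl | hz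
    · exact ⟨p, List.subset_cons_self e p, hp⟩
    · obtain ⟨q, hq, hqz⟩ := ih hz
      exact ⟨q, List.subset_cons_of_subset e hq, hqz⟩

lemma IsTrail.reverse_isChain {p : List E} {u : α} (h : IsTrail tail head r p u) :
    p.reverse.IsChain (fun e f => head e = tail f) ∧ (p.map tail).Nodup ∧ u ∉ p.map tail ∧
      (∀ e, p.head? = some e → head e = u) ∧
      (p = [] → u = r) ∧ ∀ e, p.getLast? = some e → tail e = r := by
  induction h with
  | nil => simp
  | cons e p hp he ih =>
    obtain ⟨hc, hn, hu, hh, hnil, hl⟩ := ih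
    refine ⟨?_, ?_, he, by simp, by simp, ?_⟩
    · rw [List.reverse_cons, List.isChain_append]
      refine ⟨hc, by simp, ?_⟩
      intro x hx y hy
      simp only [List.getLast?_reverse, Option.mem_def] at hx
      simp only [List.head?_cons, Option.mem_def, Option.some.injEq] at hy
      rw [hh x hx, hy]
    · rw [List.map_cons, List.nodup_cons]
      exact ⟨hu, hn⟩
    · intro f hf
      cases p with
      | nil =>
        have : e = f := by simpa using hf
        rw [← this, hnil rfl]
      | cons g p => exact hl f (by simpa using hf)

lemma IsTrail.isRVPath {F : Set E} {e : E} {p : List E} (h : IsTrail tail head r (e :: p) v)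
    (hF : ∀ f ∈ e :: p, f ∈ F) : IsRVPath tail head F r v (e :: p).reverse := by
  obtain ⟨hc, hn, hu, hh, -, hl⟩ := h.reverse_isChain
  refine ⟨fun f hf => hF f (List.mem_reverse.1 hf), hc, ?_, ?_, ?_, ?_⟩
  · rw [List.map_reverse, List.nodup_reverse]
    exact hn
  · intro f hf hfv
    exact hu (List.mem_map.2 ⟨f, List.mem_reverse.1 hf, hfv⟩)
  · rw [List.head?_reverse]
    exact ⟨_, List.getLast?_eq_some_getLast (List.cons_ne_nil e p),
      hl _ (List.getLast?_eq_some_getLast _)⟩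
  · rw [List.getLast?_reverse]
    exact ⟨e, rfl, hh e rfl⟩

lemma exists_isTrail_of_excess_pos [DecidableEq α] {F : Finset E} {u : α} (hu : u ≠ v)
    (hF : ∀ e ∈ F, tail e ≠ v)
    (hex : ∀ w, w ≠ v → w ≠ r → (if u = w then 1 else 0) ≤ excess tail head F w) :
    ∃ p, IsTrail tail head r p u ∧ ∀ f ∈ p, f ∈ F := by
  classical
  induction hn : F.card generalizing F u with
  | zero =>
    by_cases hur : u = r
    · exact ⟨[], hur ▸ IsTrail.nil, by simp⟩
    · have := hex u hu hur
      rw [Finset.card_eq_zero.1 hn] at this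
      simp [excess] at this
  | succ n ih =>
    by_cases hur : u = r
    · exact ⟨[], hur ▸ IsTrail.nil, by simp⟩
    have hpos := hex u hu hur
    rw [if_pos rfl] at hpos
    obtain ⟨e, he, hlt⟩ : ∃ e ∈ F, (0 : ℤ) <
        (if head e = u then 1 else 0) - (if tail e = u then 1 else 0) := by
      by_contra! hcon
      have := Finset.sum_nonpos hcon
      rw [excess] at hpos
      have h2 : (1 : ℤ) ≤ 0 := hpos.trans (by convert this)
      lia
    have hhe : head e = u := by by_contra h; rw [if_neg h] at hlt; split_ifs at hlt <;> lia
    have hte : tail e ≠ u := by intro h; rw [if_pos hhe, if_pos h] at hlt; lia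
    obtain ⟨p, hp, hpF⟩ := ih (F := F.erase e) (u := tail e) (hF e he)
      (fun f hf => hF f (Finset.mem_of_mem_erase hf)) (fun w hwv hwr => by
        rw [excess_erase he, hhe]
        have := hex w hwv hwr
        lia) (by rw [Finset.card_erase_of_mem he, hn]; rfl)
    by_cases hmem : u ∈ p.map tail
    · obtain ⟨q, hq, hqu⟩ := hp.exists_subset_of_mem hmem
      exact ⟨q, hqu, fun f hf => Finset.mem_of_mem_erase (hpF f (hq hf))⟩
    · refine ⟨e :: p, hhe ▸ IsTrail.cons e p hp ?_, ?_⟩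
      · rw [hhe, List.map_cons, List.mem_cons]
        rintro (h | h)
        exacts [hte h.symm, hmem h]
      · intro f hf
        rcases List.mem_cons.1 hf with rfl | hf
        exacts [he, Finset.mem_of_mem_erase (hpF f hf)]

lemma IsFlow.exists_isLinking {F X : Finset E} (h : IsFlow tail head r v F X) :
    ∃ P, IsLinking tail head r v F X P := by
  classical
  induction X using Finset.induction_on generalizing F with
  | empty => exact ⟨fun _ => [], by simp [IsLinking]⟩
  | insert e X heX ih =>
    obtain ⟨heF, hev⟩ := (h.mem_iff e).1 (Finset.mem_insert_self e X)
    have hte := h.tail_ne e heF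
    obtain ⟨p, hp, hpF⟩ := exists_isTrail_of_excess_pos (F := F.erase e) (head := head) (r := r) hte
      (fun f hf => h.tail_ne f (Finset.mem_of_mem_erase hf)) (fun w hwv hwr => by
        rw [excess_erase heF, h.excess_eq_zero w hwv hwr, hev, if_neg hwv.symm]
        lia)
    have hpF' : ∀ f ∈ e :: p, f ∈ F := by
      intro f hf
      rcases List.mem_cons.1 hf with rfl | hf
      exacts [heF, Finset.mem_of_mem_erase (hpF f hf)]
    have hQ : IsRVPath tail head F r v (e :: p).reverse := by
      refine IsTrail.isRVPath (hev ▸ IsTrail.cons e p hp ?_) (fun f hf => hpF' f hf)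
      rw [hev]
      intro hmem
      obtain ⟨f, hf, hfv⟩ := List.mem_map.1 hmem
      exact h.tail_ne f (hpF' f hf) hfv
    set Q := (e :: p).reverse with hQdef
    have hlast : Q.getLast? = some e := by simp [hQdef]
    have hsub : Q.toFinset ⊆ F := fun f hf => hQ.1 f (List.mem_toFinset.1 hf)
    have hflow : IsFlow tail head r v (F \ Q.toFinset) X := by
      refine ⟨fun f hf => h.tail_ne f (Finset.mem_sdiff.1 hf).1, fun f => ?_, fun hrv => ?_,
        fun w hwv hwr => ?_⟩
      · rw [Finset.mem_sdiff, List.mem_toFinset]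
        constructor
        · intro hf
          obtain ⟨hfF, hfv⟩ := (h.mem_iff f).1 (Finset.mem_insert_of_mem hf)
          refine ⟨⟨hfF, fun hfQ => ?_⟩, hfv⟩
          have := getLast?_eq_of_head_eq hQ.2.1 hQ.2.2.2.1 hfQ hfv
          rw [hlast] at this
          cases this
          exact heX hf
        · rintro ⟨⟨hfF, hfQ⟩, hfv⟩
          rcases Finset.mem_insert.1 ((h.mem_iff f).2 ⟨hfF, hfv⟩) with rfl | hf
          · exact absurd (List.mem_of_getLast? hlast) hfQ
          · exact hf
      · rw [excess_sdiff hsub, hQ.excess_toFinset, h.excess_root hrv, if_neg hrv.symm, if_pos rfl,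
          Finset.card_insert_of_notMem heX]
        push_cast
        ring
      · rw [excess_sdiff hsub, hQ.excess_toFinset, h.excess_eq_zero w hwv hwr, if_neg hwv.symm,
          if_neg hwr.symm]
        ring
    obtain ⟨P, hP, hd⟩ := ih hflow
    have hdisj : ∀ f ∈ X, ∀ g ∈ P f, g ∉ Q := by
      intro f hf g hg hgQ
      have := (hP f hf).1.1 g hg
      simp [hgQ] at this
    have hne : ∀ f ∈ X, f ≠ e := fun f hf hfe => heX (hfe ▸ hf)
    refine ⟨Function.update P e Q, ?_, ?_⟩
    · intro f hf
      rcases Finset.mem_insert.1 (Finset.mem_coe.1 hf) with rfl | hf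
      · rw [Function.update_self]
        exact ⟨hQ, hlast⟩
      · rw [Function.update_of_ne (hne f hf)]
        refine ⟨⟨fun g hg => ?_, (hP f hf).1.2⟩, (hP f hf).2⟩
        exact (Finset.mem_sdiff.1 (Finset.mem_coe.1 ((hP f hf).1.1 g hg))).1
    · intro f hf g hg hfg
      rcases Finset.mem_insert.1 (Finset.mem_coe.1 hf) with rfl | hfX <;>
        rcases Finset.mem_insert.1 (Finset.mem_coe.1 hg) with rfl | hgX
      · exact absurd rfl hfg
      · rw [Function.update_self, Function.update_of_ne (hne g hgX)]
        exact fun a ha ha' => hdisj g hgX a ha' ha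
      · rw [Function.update_self, Function.update_of_ne (hne f hfX)]
        exact hdisj f hfX
      · rw [Function.update_of_ne (hne f hfX), Function.update_of_ne (hne g hgX)]
        exact hd f hfX g hgX hfg

lemma gammoidIndep_iff_exists_isFlow [Finite E] {X : Finset E} :
    GammoidIndep tail head r v (X : Set E) ↔ ∃ F, IsFlow tail head r v F X := by
  classical
  rw [gammoidIndep_iff_exists_isLinking]
  constructor
  · rintro ⟨P, hP⟩
    exact exists_flow_of_isLinking hP
  · rintro ⟨F, hF⟩
    obtain ⟨P, hP, hd⟩ := hF.exists_isLinking
    exact ⟨P, fun e he => ⟨⟨fun _ _ => trivial, (hP e he).1.2⟩, (hP e he).2⟩, hd⟩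

lemma exists_toggle_of_excess_lt [DecidableEq α] {F G : Finset E} {u : α}
    (h : excess tail head G u < excess tail head F u) :
    (∃ e ∈ F, e ∉ G ∧ head e = u) ∨ ∃ e ∈ G, e ∉ F ∧ tail e = u := by
  classical
  by_contra! hcon
  refine h.not_ge ?_
  rw [excess, excess, ← Finset.sum_inter_add_sum_sdiff F G, ← Finset.sum_inter_add_sum_sdiff G F,
    Finset.inter_comm G F]
  refine add_le_add le_rfl ((Finset.sum_nonpos fun e he => ?_).trans
    (Finset.sum_nonneg fun e he => ?_))
  · rw [Finset.mem_sdiff] at he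
    rw [if_neg (hcon.1 e he.1 he.2)]
    split_ifs <;> simp
  · rw [Finset.mem_sdiff] at he
    rw [if_neg (hcon.2 e he.1 he.2)]
    split_ifs <;> simp

/-- Push one unit of excess from `u` towards `v` along edges on which `F` and `G` differ. -/
lemma exists_insert_of_excess [DecidableEq α] [DecidableEq E] {F G : Finset E} {u : α} {k m : ℤ}
    (hkm : k < m)
    (hexG : ∀ w, w ≠ v → excess tail head G w = -m * (if r = w then 1 else 0))
    (hu : u ≠ v) (hF : ∀ e ∈ F, tail e ≠ v)
    (hexF : ∀ w, w ≠ v → excess tail head F w =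
      (if u = w then 1 else 0) - (k + 1) * (if r = w then 1 else 0)) :
    ∃ H, ∃ e ∈ G, e ∉ F ∧ head e = v ∧ (∀ f ∈ H, tail f ≠ v) ∧
      (∀ w, w ≠ v → excess tail head H w = -(k + 1) * (if r = w then 1 else 0)) ∧
      ∀ f, head f = v → (f ∈ H ↔ f = e ∨ f ∈ F) := by
  induction hn : (F \ G).card + (G \ F).card using Nat.strong_induction_on generalizing F u with
  | _ n ih =>
  have hlt : excess tail head G u < excess tail head F u := by
    rw [hexG u hu, hexF u hu, if_pos rfl]
    split_ifs <;> lia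
  rcases exists_toggle_of_excess_lt hlt with ⟨e, heF, heG, rfl⟩ | ⟨e, heG, heF, rfl⟩
  · obtain ⟨H, g, hgG, hgF, hgv, hH, hexH, hmem⟩ := ih _ (by
        rw [← hn]
        have h1 : F.erase e \ G = (F \ G).erase e := by grind
        have h2 : G \ F.erase e = G \ F := by grind
        have h3 : e ∈ F \ G := by grind
        rw [h1, h2]
        exact Nat.add_lt_add_right (Finset.card_erase_lt_of_mem h3) _) (hF e heF)
      (fun f hf => hF f (Finset.mem_of_mem_erase hf)) (fun w hw => by
        rw [excess_erase heF, hexF w hw]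
        ring) rfl
    refine ⟨H, g, hgG, ?_, hgv, hH, hexH, ?_⟩
    · grind
    · grind
  · by_cases hev : head e = v
    · refine ⟨insert e F, e, heG, heF, hev, ?_, ?_, ?_⟩
      · grind
      · intro w hw
        rw [excess_insert heF, hexF w hw, hev, if_neg hw.symm]
        ring
      · grind
    obtain ⟨H, g, hgG, hgF, hgv, hH, hexH, hmem⟩ := ih _ (by
        rw [← hn]
        have h1 : insert e F \ G = F \ G := by grind
        have h2 : G \ insert e F = (G \ F).erase e := by grind
        have h3 : e ∈ G \ F := by grind
        rw [h1, h2]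
        exact Nat.add_lt_add_left (Finset.card_erase_lt_of_mem h3) _) hev
      (F := insert e F) (by grind) (fun w hw => by
        rw [excess_insert heF, hexF w hw]
        ring) rfl
    refine ⟨H, g, hgG, ?_, hgv, hH, hexH, ?_⟩
    · grind
    · grind

lemma IsFlow.excess_eq [DecidableEq α] {F X : Finset E} (h : IsFlow tail head r v F X) {w : α}
    (hw : w ≠ v) : excess tail head F w = -(X.card : ℤ) * (if r = w then 1 else 0) := by
  split_ifs with hr
  · subst hr
    rw [h.excess_root hw, mul_one]
  · rw [h.excess_eq_zero w hw (Ne.symm hr), mul_zero]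

lemma IsFlow.exists_insert [DecidableEq E] {F G X Y : Finset E} (hrv : r ≠ v)
    (hX : IsFlow tail head r v F X) (hY : IsFlow tail head r v G Y) (hlt : X.card < Y.card) :
    ∃ e ∈ Y, e ∉ X ∧ ∃ H, IsFlow tail head r v H (insert e X) := by
  classical
  obtain ⟨H, e, heG, heF, hev, hH, hexH, hmem⟩ := exists_insert_of_excess
    (k := X.card) (m := Y.card) (r := r) (by exact_mod_cast hlt)
    (fun w hw => hY.excess_eq hw) hrv hX.tail_ne (fun w hw => by rw [hX.excess_eq hw]; ring)
  have heX : e ∉ X := fun h => heF ((hX.mem_iff e).1 h).1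
  refine ⟨e, (hY.mem_iff e).2 ⟨heG, hev⟩, heX, H, hH, fun f => ?_, fun _ => ?_, fun w hw hwr => ?_⟩
  · have := hX.mem_iff f
    have := hmem f
    grind
  · rw [hexH r hrv, Finset.card_insert_of_notMem heX, if_pos rfl]
    push_cast
    ring
  · rw [hexH w hw, if_neg hwr.symm, mul_zero]

lemma GammoidIndep.eq_empty_of_root_eq {X : Set E} (h : GammoidIndep tail head r r X) : X = ∅ := by
  obtain ⟨P, hP, -, hX⟩ := h
  refine Set.eq_empty_of_forall_notMem fun e he => ?_
  obtain ⟨i, -⟩ := (hX e).1 he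
  obtain ⟨f, hf, hfr⟩ := (hP i).2.2.2.2.1
  exact (hP i).2.2.2.1 f (List.mem_of_mem_head? hf) hfr

end Linkings

/-- the independent sets of the gammoid `G_D(v)` form a matroid
on the ground set `in_D(v)`: every independent set consists of edges with head
`v`, the empty set is independent, subsets of independent sets are independent,
and the augmentation property holds. -/
theorem gammoid_is_matroid
    {α E : Type*} [Fintype α] [Fintype E] (tail head : E → α) (r v : α) :
    GammoidIndep tail head r v (∅ : Set E) ∧
    (∀ X : Set E, GammoidIndep tail head r v X → ∀ e ∈ X, head e = v) ∧
    (∀ X Y : Set E, Y ⊆ X → GammoidIndep tail head r v X → GammoidIndep tail head r v Y) ∧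
    (∀ X Y : Set E, GammoidIndep tail head r v X → GammoidIndep tail head r v Y →
      X.ncard < Y.ncard → ∃ e ∈ Y \ X, GammoidIndep tail head r v (insert e X)) := by
  classical
  refine ⟨?_, ?_, ?_, ?_⟩
  · rw [gammoidIndep_iff_exists_isLinking]
    exact ⟨fun _ => [], by simp [IsLinking]⟩
  · rintro X ⟨P, hP, -, hX⟩ e he
    obtain ⟨i, hi⟩ := (hX e).1 he
    obtain ⟨f, hf, hfv⟩ := (hP i).2.2.2.2.2
    rw [hi] at hf
    rwa [Option.some.inj hf]
  · intro X Y hYX hX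
    rw [gammoidIndep_iff_exists_isLinking] at hX ⊢
    obtain ⟨P, hP⟩ := hX
    exact ⟨P, hP.mono hYX⟩
  · intro X Y hX hY hlt
    by_cases hrv : r = v
    · subst hrv
      rw [hY.eq_empty_of_root_eq, Set.ncard_empty] at hlt
      exact absurd hlt (Nat.not_lt_zero _)
    lift X to Finset E using X.toFinite
    lift Y to Finset E using Y.toFinite
    rw [Set.ncard_coe_finset, Set.ncard_coe_finset] at hlt
    obtain ⟨F, hF⟩ := gammoidIndep_iff_exists_isFlow.1 hX
    obtain ⟨G, hG⟩ := gammoidIndep_iff_exists_isFlow.1 hY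
    obtain ⟨e, heY, heX, hH⟩ := hF.exists_insert hrv hG hlt
    refine ⟨e, ⟨heY, heX⟩, ?_⟩
    rw [← Finset.coe_insert]
    exact gammoidIndep_iff_exists_isFlow.2 hH
end
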